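/- arXiv:1209.5325 — 2 statements merged into one kernel-verified Lean document; each statement's English description precedes it below -/
import Mathlib

section
/- The class of languages recognized by TOPL automata is closed under concatenation: for any two TOPL automata A₁ and A₂ over the same alphabet Σ = V^n, there exists a TOPL automaton B over Σ with L(B) = L(A₁)·L(A₂) = { w₁ w₂ | w₁ ∈ L(A₁), w₂ ∈ L(A₂) }. -/
namespace Topl

/-- Guards over `m` registers and letters that are `n`-tuples. -/
inductive Guard (m n : ℕ) : Type
  | eq : Fin m → Fin n → Guard m n
  | neq : Fin m → Fin n → Guard m n
  | tt : Guard m n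
  | and : Guard m n → Guard m n → Guard m n
  deriving DecidableEq

/-- Actions over `m` registers and letters that are `n`-tuples. -/
inductive Action (m n : ℕ) : Type
  | nop : Action m n
  | set : Fin m → Fin n → Action m n
  | seq : Action m n → Action m n → Action m n
  deriving DecidableEq

/-- Satisfaction of a guard by a store `s` and a letter `ℓ`. -/
def Guard.Sat {V : Type} {m n : ℕ} (s : Fin m → V) (ℓ : Fin n → V) : Guard m n → Prop
  | .eq i j => s i = ℓ j
  | .neq i j => s i ≠ ℓ j
  | .tt => True
  | .and g₁ g₂ => Guard.Sat s ℓ g₁ ∧ Guard.Sat s ℓ g₂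

/-- The store transformation of an action on input letter `ℓ`:
`nop(ℓ)(s) = s`, `(set i := j)(ℓ)(s) = s[i ↦ ℓ(j)]`, `(a₁;a₂)(ℓ) = a₁(ℓ) ∘ a₂(ℓ)`. -/
def Action.run {V : Type} {m n : ℕ} (ℓ : Fin n → V) : Action m n → (Fin m → V) → (Fin m → V)
  | .nop, s => s
  | .set i j, s => Function.update s i (ℓ j)
  | .seq a₁ a₂, s => Action.run ℓ a₁ (Action.run ℓ a₂ s)

/-- A TOPL automaton with `m` registers over `n`-tuples, whose set of states is `Fin k`. -/
structure TOPL (V : Type) (m n k : ℕ) where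
  q₀ : Fin k
  s₀ : Fin m → V
  δ : Finset (Fin k × (Guard m n × Action m n) × Fin k)
  F : Finset (Fin k)

namespace TOPL

variable {V : Type} {m n k : ℕ}

/-- One edge of the configuration graph, labelled by a letter. -/
def Step (A : TOPL V m n k) (x₁ : Fin k × (Fin m → V)) (ℓ : Fin n → V)
    (x₂ : Fin k × (Fin m → V)) : Prop :=
  ∃ g a, (x₁.1, (g, a), x₂.1) ∈ A.δ ∧ Guard.Sat x₁.2 ℓ g ∧ Action.run ℓ a x₁.2 = x₂.2

/-- Walks in the configuration graph, labelled by words. -/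
inductive Reach (A : TOPL V m n k) :
    Fin k × (Fin m → V) → List (Fin n → V) → Fin k × (Fin m → V) → Prop
  | nil (x) : Reach A x [] x
  | cons {x₁ x₂ x₃ ℓ w} : A.Step x₁ ℓ x₂ → Reach A x₂ w x₃ → Reach A x₁ (ℓ :: w) x₃

/-- The language of a TOPL automaton: words labelling walks from the initial
configuration to a configuration whose state is final. -/
def Lang (A : TOPL V m n k) : Set (List (Fin n → V)) :=
  { w | ∃ x, A.Reach (A.q₀, A.s₀) w x ∧ x.1 ∈ A.F }

end TOPL

/-- Rename the registers of a guard. -/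
def Guard.map {m m' n : ℕ} (f : Fin m → Fin m') : Guard m n → Guard m' n
  | .eq i j => .eq (f i) j
  | .neq i j => .neq (f i) j
  | .tt => .tt
  | .and g₁ g₂ => .and (g₁.map f) (g₂.map f)

/-- Rename the registers of an action. -/
def Action.map {m m' n : ℕ} (f : Fin m → Fin m') : Action m n → Action m' n
  | .nop => .nop
  | .set i j => .set (f i) j
  | .seq a₁ a₂ => .seq (a₁.map f) (a₂.map f)

theorem Guard.sat_map {V : Type} {m m' n : ℕ} (f : Fin m → Fin m') (s : Fin m' → V)
    (ℓ : Fin n → V) (g : Guard m n) : (g.map f).Sat s ℓ ↔ g.Sat (s ∘ f) ℓ := by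
  induction g <;> simp_all [Guard.map, Guard.Sat]

theorem Action.run_map_comp {V : Type} {m m' n : ℕ} {f : Fin m → Fin m'}
    (hf : Function.Injective f) (ℓ : Fin n → V) (a : Action m n) (s : Fin m' → V) :
    (a.map f).run ℓ s ∘ f = a.run ℓ (s ∘ f) := by
  induction a generalizing s with
  | nop => rfl
  | set i j => exact Function.update_comp_eq_of_injective s hf i (ℓ j)
  | seq a₁ a₂ ih₁ ih₂ => simp [Action.map, Action.run, ih₁, ih₂]

theorem Action.run_map_comp_of_disjoint {V : Type} {m m' p n : ℕ} {f : Fin m → Fin m'}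
    {h : Fin p → Fin m'} (hfh : ∀ i j, h j ≠ f i) (ℓ : Fin n → V) (a : Action m n)
    (s : Fin m' → V) : (a.map f).run ℓ s ∘ h = s ∘ h := by
  induction a generalizing s with
  | nop => rfl
  | set i j =>
    funext r
    exact Function.update_of_ne (hfh i r) _ _
  | seq a₁ a₂ ih₁ ih₂ => simp [Action.map, Action.run, ih₁, ih₂]

namespace TOPL

/-- The word `w` labels a walk from the configuration `x` to a final state. -/
def Accepts {V : Type} {m n k : ℕ} (A : TOPL V m n k) (x : Fin k × (Fin m → V))
    (w : List (Fin n → V)) : Prop :=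
  ∃ y, A.Reach x w y ∧ y.1 ∈ A.F

theorem accepts_nil {V : Type} {m n k : ℕ} (A : TOPL V m n k) (x : Fin k × (Fin m → V)) :
    A.Accepts x [] ↔ x.1 ∈ A.F := by
  constructor
  · rintro ⟨y, hy, hF⟩
    cases hy
    exact hF
  · exact fun h => ⟨x, .nil x, h⟩

theorem accepts_cons {V : Type} {m n k : ℕ} (A : TOPL V m n k) (q : Fin k) (s : Fin m → V)
    (ℓ : Fin n → V) (w : List (Fin n → V)) :
    A.Accepts (q, s) (ℓ :: w) ↔
      ∃ g a q', (q, (g, a), q') ∈ A.δ ∧ g.Sat s ℓ ∧ A.Accepts (q', a.run ℓ s) w := by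
  constructor
  · rintro ⟨y, hy, hF⟩
    cases hy with
    | @cons _ z _ _ _ hstep hreach =>
      obtain ⟨q', s'⟩ := z
      obtain ⟨g, a, hδ, hg, ha⟩ := hstep
      dsimp only at hδ hg ha
      subst ha
      exact ⟨g, a, q', hδ, hg, y, hreach, hF⟩
  · rintro ⟨g, a, q', hδ, hg, y, hreach, hF⟩
    exact ⟨y, .cons ⟨g, a, hδ, hg, rfl⟩ hreach, hF⟩

/-- The concatenation automaton: it runs `A₁` on the first `m₁` registers, and in a final state
of `A₁` it may take a transition out of the initial state of `A₂`, which it runs on the last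
`m₂` registers. -/
def concat {V : Type} {m₁ m₂ n k₁ k₂ : ℕ} (A₁ : TOPL V m₁ n k₁) (A₂ : TOPL V m₂ n k₂) :
    TOPL V (m₁ + m₂) n (k₁ + k₂) where
  q₀ := Fin.castAdd k₂ A₁.q₀
  s₀ := Fin.append A₁.s₀ A₂.s₀
  δ :=
    A₁.δ.image (fun t => (Fin.castAdd k₂ t.1,
      (t.2.1.1.map (Fin.castAdd m₂), t.2.1.2.map (Fin.castAdd m₂)), Fin.castAdd k₂ t.2.2)) ∪
    A₂.δ.image (fun t => (Fin.natAdd k₁ t.1,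
      (t.2.1.1.map (Fin.natAdd m₁), t.2.1.2.map (Fin.natAdd m₁)), Fin.natAdd k₁ t.2.2)) ∪
    (A₁.F ×ˢ A₂.δ.filter (fun t => t.1 = A₂.q₀)).image (fun t => (Fin.castAdd k₂ t.1,
      (t.2.2.1.1.map (Fin.natAdd m₁), t.2.2.1.2.map (Fin.natAdd m₁)), Fin.natAdd k₁ t.2.2.2))
  F := A₂.F.image (Fin.natAdd k₁) ∪
    if A₂.q₀ ∈ A₂.F then A₁.F.image (Fin.castAdd k₂) else ∅

section Concat

variable {V : Type} {m₁ m₂ n k₁ k₂ : ℕ} (A₁ : TOPL V m₁ n k₁) (A₂ : TOPL V m₂ n k₂)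

theorem castAdd_ne_natAdd {a b : ℕ} (i : Fin a) (j : Fin b) :
    Fin.castAdd b i ≠ Fin.natAdd a j := by
  intro h
  have := congrArg Fin.val h
  simp at this
  omega

theorem natAdd_mem_concat_F (q : Fin k₂) :
    Fin.natAdd k₁ q ∈ (A₁.concat A₂).F ↔ q ∈ A₂.F := by
  by_cases h : A₂.q₀ ∈ A₂.F <;> simp [concat, h, castAdd_ne_natAdd]

theorem castAdd_mem_concat_F (q : Fin k₁) :
    Fin.castAdd k₂ q ∈ (A₁.concat A₂).F ↔ q ∈ A₁.F ∧ A₂.q₀ ∈ A₂.F := by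
  by_cases h : A₂.q₀ ∈ A₂.F <;> simp [concat, h, (castAdd_ne_natAdd _ _).symm]

theorem natAdd_mem_concat_δ (q : Fin k₂) (t) (q' : Fin (k₁ + k₂)) :
    (Fin.natAdd k₁ q, t, q') ∈ (A₁.concat A₂).δ ↔
      ∃ g a p, (q, (g, a), p) ∈ A₂.δ ∧
        t = (g.map (Fin.natAdd m₁), a.map (Fin.natAdd m₁)) ∧ q' = Fin.natAdd k₁ p := by
  simp only [concat, Finset.mem_union, Finset.mem_image, Prod.exists, Prod.mk.injEq,
    castAdd_ne_natAdd, Fin.natAdd_inj, false_and, and_false, exists_false, or_false, false_or]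
  constructor
  · rintro ⟨_, g, a, p, h, rfl, rfl, rfl⟩
    exact ⟨g, a, p, h, rfl, rfl⟩
  · rintro ⟨g, a, p, h, rfl, rfl⟩
    exact ⟨q, g, a, p, h, rfl, rfl, rfl⟩

theorem castAdd_mem_concat_δ (q : Fin k₁) (t) (q' : Fin (k₁ + k₂)) :
    (Fin.castAdd k₂ q, t, q') ∈ (A₁.concat A₂).δ ↔
      (∃ g a p, (q, (g, a), p) ∈ A₁.δ ∧
        t = (g.map (Fin.castAdd m₂), a.map (Fin.castAdd m₂)) ∧ q' = Fin.castAdd k₂ p) ∨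
      (q ∈ A₁.F ∧ ∃ g a p, (A₂.q₀, (g, a), p) ∈ A₂.δ ∧
        t = (g.map (Fin.natAdd m₁), a.map (Fin.natAdd m₁)) ∧ q' = Fin.natAdd k₁ p) := by
  simp only [concat, Finset.mem_union, Finset.mem_image, Finset.mem_product, Finset.mem_filter,
    Prod.exists, Prod.mk.injEq, (castAdd_ne_natAdd _ _).symm, Fin.castAdd_inj, false_and,
    and_false, exists_false, or_false]
  constructor
  · rintro (⟨_, g, a, p, h, rfl, rfl, rfl⟩ | ⟨_, _, g, a, p, ⟨hF, h, rfl⟩, rfl, rfl, rfl⟩)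
    · exact .inl ⟨g, a, p, h, rfl, rfl⟩
    · exact .inr ⟨hF, g, a, p, h, rfl, rfl⟩
  · rintro (⟨g, a, p, h, rfl, rfl⟩ | ⟨hF, g, a, p, h, rfl, rfl⟩)
    · exact .inl ⟨q, g, a, p, h, rfl, rfl, rfl⟩
    · exact .inr ⟨q, _, g, a, p, ⟨hF, h, rfl⟩, rfl, rfl, rfl⟩

theorem concat_accepts_natAdd (w : List (Fin n → V)) (q : Fin k₂) (s : Fin (m₁ + m₂) → V) :
    (A₁.concat A₂).Accepts (Fin.natAdd k₁ q, s) w ↔ A₂.Accepts (q, s ∘ Fin.natAdd m₁) w := by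
  induction w generalizing q s with
  | nil => simp only [accepts_nil, natAdd_mem_concat_F]
  | cons ℓ w ih =>
    simp only [accepts_cons, natAdd_mem_concat_δ]
    constructor
    · rintro ⟨_, _, _, ⟨g, a, p, h, ht, rfl⟩, hg, hw⟩
      obtain ⟨rfl, rfl⟩ := Prod.mk.inj ht
      rw [ih, Action.run_map_comp (Fin.natAdd_injective _ _)] at hw
      exact ⟨g, a, p, h, (Guard.sat_map _ _ _ _).1 hg, hw⟩
    · rintro ⟨g, a, p, h, hg, hw⟩
      refine ⟨_, _, _, ⟨g, a, p, h, rfl, rfl⟩, (Guard.sat_map _ _ _ _).2 hg, ?_⟩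
      rwa [ih, Action.run_map_comp (Fin.natAdd_injective _ _)]

theorem concat_accepts_castAdd (w : List (Fin n → V)) (q : Fin k₁) (s : Fin (m₁ + m₂) → V)
    (hs : s ∘ Fin.natAdd m₁ = A₂.s₀) :
    (A₁.concat A₂).Accepts (Fin.castAdd k₂ q, s) w ↔
      ∃ w₁ w₂, A₁.Accepts (q, s ∘ Fin.castAdd m₂) w₁ ∧ A₂.Accepts (A₂.q₀, A₂.s₀) w₂ ∧
        w = w₁ ++ w₂ := by
  induction w generalizing q s with
  | nil =>
    simp only [accepts_nil, castAdd_mem_concat_F]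
    constructor
    · rintro ⟨h₁, h₂⟩
      exact ⟨[], [], (accepts_nil _ _).2 h₁, (accepts_nil _ _).2 h₂, rfl⟩
    · rintro ⟨w₁, w₂, h₁, h₂, h⟩
      obtain ⟨rfl, rfl⟩ := List.append_eq_nil_iff.1 h.symm
      exact ⟨(accepts_nil _ _).1 h₁, (accepts_nil _ _).1 h₂⟩
  | cons ℓ w ih =>
    have keep (a : Action m₁ n) :
        (a.map (Fin.castAdd m₂)).run ℓ s ∘ Fin.natAdd m₁ = A₂.s₀ :=
      (Action.run_map_comp_of_disjoint (fun _ _ => (castAdd_ne_natAdd _ _).symm) ℓ a s).trans hs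
    simp only [accepts_cons, castAdd_mem_concat_δ]
    constructor
    · rintro ⟨_, _, _, ⟨g, a, p, h, ht, rfl⟩ | ⟨hF, g, a, p, h, ht, rfl⟩, hg, hw⟩ <;>
        obtain ⟨rfl, rfl⟩ := Prod.mk.inj ht
      · rw [ih _ _ (keep a), Action.run_map_comp (Fin.castAdd_injective _ _)] at hw
        obtain ⟨w₁, w₂, h₁, h₂, rfl⟩ := hw
        exact ⟨ℓ :: w₁, w₂,
          (accepts_cons _ _ _ _ _).2 ⟨g, a, p, h, (Guard.sat_map _ _ _ _).1 hg, h₁⟩, h₂, rfl⟩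
      · rw [concat_accepts_natAdd, Action.run_map_comp (Fin.natAdd_injective _ _), hs] at hw
        rw [Guard.sat_map, hs] at hg
        exact ⟨[], ℓ :: w, (accepts_nil _ _).2 hF,
          (accepts_cons _ _ _ _ _).2 ⟨g, a, p, h, hg, hw⟩, rfl⟩
    · rintro ⟨w₁, w₂, h₁, h₂, hw⟩
      cases w₁ with
      | nil =>
        obtain rfl : ℓ :: w = w₂ := hw
        obtain ⟨g, a, p, h, hg, hw⟩ := (accepts_cons _ _ _ _ _).1 h₂
        refine ⟨_, _, _, .inr ⟨(accepts_nil _ _).1 h₁, g, a, p, h, rfl, rfl⟩, ?_, ?_⟩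
        · rwa [Guard.sat_map, hs]
        · rwa [concat_accepts_natAdd, Action.run_map_comp (Fin.natAdd_injective _ _), hs]
      | cons ℓ' w₁ =>
        obtain ⟨rfl, rfl⟩ := List.cons.inj hw
        obtain ⟨g, a, p, h, hg, hw⟩ := (accepts_cons _ _ _ _ _).1 h₁
        refine ⟨_, _, _, .inl ⟨g, a, p, h, rfl, rfl⟩, (Guard.sat_map _ _ _ _).2 hg, ?_⟩
        rw [ih _ _ (keep a), Action.run_map_comp (Fin.castAdd_injective _ _)]
        exact ⟨w₁, w₂, hw, h₂, rfl⟩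

end Concat

end TOPL

/-- TOPL-recognizable languages are closed under concatenation. -/
theorem topl_closed_under_concatenation (V : Type) [Infinite V] (n : ℕ)
    (m₁ k₁ m₂ k₂ : ℕ) (A₁ : TOPL V m₁ n k₁) (A₂ : TOPL V m₂ n k₂) :
    ∃ (m k : ℕ) (B : TOPL V m n k),
      B.Lang = { w | ∃ w₁ w₂, w₁ ∈ A₁.Lang ∧ w₂ ∈ A₂.Lang ∧ w = w₁ ++ w₂ } := by
  refine ⟨m₁ + m₂, k₁ + k₂, A₁.concat A₂, Set.ext fun w => ?_⟩
  have hl : Fin.append A₁.s₀ A₂.s₀ ∘ Fin.castAdd m₂ = A₁.s₀ :=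
    funext fun i => Fin.append_left _ _ i
  have hr : Fin.append A₁.s₀ A₂.s₀ ∘ Fin.natAdd m₁ = A₂.s₀ :=
    funext fun i => Fin.append_right _ _ i
  have h := TOPL.concat_accepts_castAdd A₁ A₂ w A₁.q₀ _ hr
  rw [hl] at h
  exact h

end Topl
end

section
/- The class of languages recognized by high-level TOPL automata is closed under intersection: for any two hl-TOPL automata A₁ and A₂ over the same alphabet Σ = V^n, there exists a hl-TOPL automaton B over Σ with L(B) = L(A₁) ∩ L(A₂). -/
namespace Topl

/-- A high-level TOPL automaton: transitions are labelled by finite sequences of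
guard–action pairs. -/
structure HlTOPL (V : Type) (m n k : ℕ) where
  q₀ : Fin k
  s₀ : Fin m → V
  δ : Finset (Fin k × List (Guard m n × Action m n) × Fin k)
  F : Finset (Fin k)

namespace HlTOPL

variable {V : Type} {m n k : ℕ}

/-- `SeqAccept s gas w s'` holds when the TOPL automaton `T(s; gas)` accepts the word `w`
ending with store `s'`. -/
inductive SeqAccept {V : Type} {m n : ℕ} :
    (Fin m → V) → List (Guard m n × Action m n) → List (Fin n → V) → (Fin m → V) → Prop
  | nil (s) : SeqAccept s [] [] s
  | cons {s s' g a gas ℓ w} : Guard.Sat s ℓ g → SeqAccept (Action.run ℓ a s) gas w s' →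
      SeqAccept s ((g, a) :: gas) (ℓ :: w) s'

/-- A standard transition starts from the hl-configuration `(x, v)`. -/
def StdFrom (A : HlTOPL V m n k) (x : Fin k × (Fin m → V)) (v : List (Fin n → V)) : Prop :=
  ∃ q₂ s₂ gas u u', v = u ++ u' ∧ (x.1, gas, q₂) ∈ A.δ ∧ SeqAccept x.2 gas u s₂

/-- One edge of the hl-configuration graph: a standard transition or a skip transition. -/
inductive HlStep (A : HlTOPL V m n k) :
    (Fin k × (Fin m → V)) × List (Fin n → V) → List (Fin n → V) →
    (Fin k × (Fin m → V)) × List (Fin n → V) → Prop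
  | std {q₁ s₁ q₂ s₂ gas w w'} : (q₁, gas, q₂) ∈ A.δ → SeqAccept s₁ gas w s₂ →
      HlStep A ((q₁, s₁), w ++ w') w ((q₂, s₂), w')
  | skip {q s ℓ w} : ¬ A.StdFrom (q, s) (ℓ :: w) → HlStep A ((q, s), ℓ :: w) [ℓ] ((q, s), w)

/-- Paths in the hl-configuration graph, labelled by the concatenation of the step labels. -/
inductive Path (A : HlTOPL V m n k) :
    (Fin k × (Fin m → V)) × List (Fin n → V) → List (Fin n → V) →
    (Fin k × (Fin m → V)) × List (Fin n → V) → Prop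
  | nil (y) : Path A y [] y
  | cons {y₁ y₂ y₃ u w} : A.HlStep y₁ u y₂ → Path A y₂ w y₃ → Path A y₁ (u ++ w) y₃

/-- The language of a high-level TOPL automaton: words labelling paths from an initial
hl-configuration to a final one. -/
def Lang (A : HlTOPL V m n k) : Set (List (Fin n → V)) :=
  { w | ∃ (w₀ : List (Fin n → V)) (q : Fin k) (s : Fin m → V),
      A.Path ((A.q₀, A.s₀), w₀) w ((q, s), ([] : List (Fin n → V))) ∧ q ∈ A.F }

end HlTOPL

/-! ### Guards and actions -/

/-- Satisfaction of a guard, given only which registers agree with which letter components. -/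
def Guard.Holds {m n : ℕ} (b : Fin m → Fin n → Prop) : Guard m n → Prop
  | .eq i j => b i j
  | .neq i j => ¬ b i j
  | .tt => True
  | .and g₁ g₂ => g₁.Holds b ∧ g₂.Holds b

theorem Guard.holds_iff_sat {V : Type} {m n : ℕ} (s : Fin m → V) (ℓ : Fin n → V)
    (g : Guard m n) : g.Holds (fun i j => s i = ℓ j) ↔ g.Sat s ℓ := by
  induction g with
  | eq i j => rfl
  | neq i j => rfl
  | tt => rfl
  | and g₁ g₂ h₁ h₂ => exact and_congr h₁ h₂

theorem Action.map_run {V W : Type} {m n : ℕ} (h : V → W) (ℓ : Fin n → V) (a : Action m n)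
    (s : Fin m → V) : h ∘ a.run ℓ s = a.run (h ∘ ℓ) (h ∘ s) := by
  induction a generalizing s with
  | nop => rfl
  | set i j => exact Function.comp_update h s i (ℓ j)
  | seq a₁ a₂ h₁ h₂ => rw [Action.run, h₁, h₂, Action.run]

/-- Running an action on symbolic values and then evaluating them is running the action. -/
theorem Action.elim_run {V X : Type} {m n : ℕ} (s : X → V) (ℓ : Fin n → V) (a : Action m n)
    (r : Fin m → X) (i : Fin m) :
    Sum.elim s ℓ (a.run Sum.inr (Sum.inl ∘ r) i) = a.run ℓ (s ∘ r) i :=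
  congrFun (a.map_run (Sum.elim s ℓ) Sum.inr (Sum.inl ∘ r)) i

theorem Guard.exists_sat_iff_forall (V : Type) {m n : ℕ} {ι : Type} (t : Finset ι)
    (g : ι → Guard m n) :
    ∃ G : Guard m n, ∀ (s : Fin m → V) (ℓ : Fin n → V), G.Sat s ℓ ↔ ∀ i ∈ t, (g i).Sat s ℓ := by
  classical
  induction t using Finset.induction_on with
  | empty => exact ⟨.tt, by simp [Guard.Sat]⟩
  | insert i t _ ih =>
    obtain ⟨G, hG⟩ := ih
    exact ⟨.and (g i) G, by simp [Guard.Sat, hG]⟩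

/-- Some guard describes exactly which registers agree with which letter components. -/
theorem Guard.exists_sat_iff_agree (V : Type) {m n : ℕ} {X : Type} [Finite X] (ρ : X → Fin m)
    (b : X → Fin n → Prop) :
    ∃ G : Guard m n, ∀ (s : Fin m → V) (ℓ : Fin n → V),
      G.Sat s ℓ ↔ (fun x j => s (ρ x) = ℓ j) = b := by
  classical
  have := Fintype.ofFinite X
  obtain ⟨G, hG⟩ := Guard.exists_sat_iff_forall V (Finset.univ : Finset (X × Fin n))
    (fun p => if b p.1 p.2 then .eq (ρ p.1) p.2 else .neq (ρ p.1) p.2)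
  refine ⟨G, fun s ℓ => ?_⟩
  rw [hG]
  constructor
  · intro h
    funext x j
    have := h (x, j) (Finset.mem_univ _)
    by_cases hb : b x j <;> simp_all [Guard.Sat]
  · rintro rfl ⟨x, j⟩ -
    by_cases hb : s (ρ x) = ℓ j <;> simp_all [Guard.Sat]

/-- Some action writes the whole letter to a given block of registers. -/
theorem Action.exists_write (V : Type) {m n : ℕ} (β : Fin n → Fin m)
    (hβ : Function.Injective β) :
    ∃ a : Action m n, ∀ (ℓ : Fin n → V) (s : Fin m → V),
      (∀ j, a.run ℓ s (β j) = ℓ j) ∧ ∀ x, x ∉ Set.range β → a.run ℓ s x = s x := by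
  classical
  suffices h : ∀ t : Finset (Fin n), ∃ a : Action m n, ∀ (ℓ : Fin n → V) (s : Fin m → V),
      (∀ j ∈ t, a.run ℓ s (β j) = ℓ j) ∧ ∀ x, x ∉ Set.range β → a.run ℓ s x = s x by
    simpa using h Finset.univ
  intro t
  induction t using Finset.induction_on with
  | empty => exact ⟨.nop, by simp [Action.run]⟩
  | insert i t _ ih =>
    obtain ⟨a, ha⟩ := ih
    refine ⟨.seq (.set (β i) i) a, fun ℓ s => ⟨fun j hj => ?_, fun x hx => ?_⟩⟩
    · by_cases hji : j = i
      · subst hji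
        simp [Action.run]
      · have := (ha ℓ s).1 j (Finset.mem_of_mem_insert_of_ne hj hji)
        simpa [Action.run, Function.update_of_ne (hβ.ne hji)] using this
    · have hne : x ≠ β i := fun h => hx ⟨i, h.symm⟩
      simpa [Action.run, Function.update_of_ne hne] using (ha ℓ s).2 x hx

/-! ### Register automata with copying -/

/-- A register automaton whose transitions depend on which registers agree with which letter
components, and update every register to the old content of some register or to a letter
component. -/
structure CopyAut (V : Type) (n : ℕ) where
  Q : Type
  X : Type
  finQ : Finite Q
  finX : Finite X
  q₀ : Q
  s₀ : X → V
  δ : Q → (X → Fin n → Prop) → Set (Q × (X → X ⊕ Fin n))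
  F : Set Q

namespace CopyAut

variable {V : Type} {n : ℕ}

/-- Acceptance of a word from a configuration. -/
def Accepts (R : CopyAut V n) : List (Fin n → V) → R.Q → (R.X → V) → Prop
  | [], q, _ => q ∈ R.F
  | ℓ :: w, q, s => ∃ q' f, (q', f) ∈ R.δ q (fun x j => s x = ℓ j) ∧
      R.Accepts w q' (Sum.elim s ℓ ∘ f)

/-- The language of a register automaton with copying. -/
def Lang (R : CopyAut V n) : Set (List (Fin n → V)) :=
  { w | R.Accepts w R.q₀ R.s₀ }

/-- The product automaton. -/
def prod (R₁ R₂ : CopyAut V n) : CopyAut V n where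
  Q := R₁.Q × R₂.Q
  X := R₁.X ⊕ R₂.X
  finQ := have := R₁.finQ; have := R₂.finQ; inferInstance
  finX := have := R₁.finX; have := R₂.finX; inferInstance
  q₀ := (R₁.q₀, R₂.q₀)
  s₀ := Sum.elim R₁.s₀ R₂.s₀
  δ q b := { p | ∃ f₁ f₂, (p.1.1, f₁) ∈ R₁.δ q.1 (b ∘ Sum.inl) ∧
    (p.1.2, f₂) ∈ R₂.δ q.2 (b ∘ Sum.inr) ∧
    p.2 = Sum.elim (Sum.map Sum.inl id ∘ f₁) (Sum.map Sum.inr id ∘ f₂) }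
  F := { q | q.1 ∈ R₁.F ∧ q.2 ∈ R₂.F }

theorem accepts_prod (R₁ R₂ : CopyAut V n) (w : List (Fin n → V)) (q₁ : R₁.Q) (q₂ : R₂.Q)
    (s₁ : R₁.X → V) (s₂ : R₂.X → V) :
    (R₁.prod R₂).Accepts w (q₁, q₂) (Sum.elim s₁ s₂) ↔
      R₁.Accepts w q₁ s₁ ∧ R₂.Accepts w q₂ s₂ := by
  induction w generalizing q₁ q₂ s₁ s₂ with
  | nil => rfl
  | cons ℓ w ih =>
    have key : ∀ (f₁ : R₁.X → R₁.X ⊕ Fin n) (f₂ : R₂.X → R₂.X ⊕ Fin n),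
        Sum.elim (Sum.elim s₁ s₂) ℓ ∘
          Sum.elim (Sum.map Sum.inl id ∘ f₁) (Sum.map Sum.inr id ∘ f₂) =
        Sum.elim (Sum.elim s₁ ℓ ∘ f₁) (Sum.elim s₂ ℓ ∘ f₂) := by
      intro f₁ f₂
      funext x
      rcases x with x | x
      · rcases h : f₁ x with y | y <;> simp [h]
      · rcases h : f₂ x with y | y <;> simp [h]
    constructor
    · rintro ⟨⟨q₁', q₂'⟩, f, ⟨f₁, f₂, h₁, h₂, hf⟩, hw⟩
      dsimp only at hf
      subst hf
      have hw' : (R₁.prod R₂).Accepts w (q₁', q₂')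
        (Sum.elim (Sum.elim s₁ ℓ ∘ f₁) (Sum.elim s₂ ℓ ∘ f₂)) := key f₁ f₂ ▸ hw
      rw [ih] at hw'
      exact ⟨⟨q₁', f₁, h₁, hw'.1⟩, ⟨q₂', f₂, h₂, hw'.2⟩⟩
    · rintro ⟨⟨q₁', f₁, h₁, hw₁⟩, ⟨q₂', f₂, h₂, hw₂⟩⟩
      refine ⟨(q₁', q₂'), _, ⟨f₁, f₂, h₁, h₂, rfl⟩, ?_⟩
      have hw' := (ih q₁' q₂' _ _).2 ⟨hw₁, hw₂⟩
      exact (key f₁ f₂).symm ▸ hw'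

theorem lang_prod (R₁ R₂ : CopyAut V n) : (R₁.prod R₂).Lang = R₁.Lang ∩ R₂.Lang :=
  Set.ext fun w => accepts_prod R₁ R₂ w _ _ _ _

/-- A block of `n` registers outside the range of an assignment of registers. -/
theorem exists_free_block {X : Type} [Finite X] (ρ : X → Fin (Nat.card X + n)) :
    ∃ β : Fin n → Fin (Nat.card X + n), Function.Injective β ∧ ∀ x, ρ x ∉ Set.range β := by
  classical
  have := Fintype.ofFinite X
  have hcard : Fintype.card (Fin n) ≤
      Fintype.card {y : Fin (Nat.card X + n) // ¬ y ∈ Finset.univ.image ρ} := by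
    have h₁ := Fintype.card_subtype_compl
      (fun y : Fin (Nat.card X + n) => y ∈ Finset.univ.image ρ)
    have h₂ : (Finset.univ.image ρ).card ≤ Fintype.card X := Finset.card_image_le
    rw [Fintype.card_coe, Fintype.card_fin] at h₁
    have h₃ := Nat.card_eq_fintype_card (α := X)
    rw [h₁, Fintype.card_fin]
    omega
  obtain ⟨e⟩ := Function.Embedding.nonempty_of_card_le hcard
  refine ⟨fun j => (e j).1, fun i j h => e.injective (Subtype.ext h), ?_⟩
  rintro x ⟨j, hj⟩
  exact (e j).2 (by simp [hj])

/-- Copying is simulated by keeping in the control state an assignment of the registers to a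
larger set of registers; skips are excluded by a silent loop on every state. -/
theorem exists_hlTOPL [Nonempty V] (R : CopyAut V n) :
    ∃ (m k : ℕ) (B : HlTOPL V m n k), B.Lang = R.Lang := by
  classical
  have := R.finQ
  have := R.finX
  set p := Nat.card R.X + n with hp
  choose β hβ hρβ using fun ρ : R.X → Fin p => exists_free_block (n := n) ρ
  choose g hg using fun (ρ : R.X → Fin p) (b : R.X → Fin n → Prop) =>
    Guard.exists_sat_iff_agree V ρ b
  choose a ha using fun ρ : R.X → Fin p => Action.exists_write V (β ρ) (hβ ρ)
  obtain ⟨k, ⟨e⟩⟩ := Finite.exists_equiv_fin (R.Q × (R.X → Fin p))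
  obtain ⟨ρ₀⟩ : Nonempty (R.X ↪ Fin p) := by
    have := Fintype.ofFinite R.X
    apply Function.Embedding.nonempty_of_card_le
    rw [Fintype.card_fin, hp, Nat.card_eq_fintype_card]
    omega
  let edge : R.Q × (R.X → Fin p) × (R.X → Fin n → Prop) × R.Q × (R.X → R.X ⊕ Fin n) →
      Fin k × List (Guard p n × Action p n) × Fin k :=
    fun t => (e (t.1, t.2.1), [(g t.2.1 t.2.2.1, a t.2.1)],
      e (t.2.2.2.1, Sum.elim t.2.1 (β t.2.1) ∘ t.2.2.2.2))
  let E : Set (Fin k × List (Guard p n × Action p n) × Fin k) :=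
    edge '' { t | t.2.2.2 ∈ R.δ t.1 t.2.2.1 } ∪ Set.range (fun x => (x, [], x))
  have hE : E.Finite := (Set.toFinite _).union (Set.toFinite _)
  let B : HlTOPL V p n k :=
    { q₀ := e (R.q₀, ρ₀)
      s₀ := Function.extend ρ₀ R.s₀ fun _ => Classical.arbitrary V
      δ := hE.toFinset
      F := Finset.univ.filter fun x => (e.symm x).1 ∈ R.F }
  have hδ : ∀ t, t ∈ B.δ ↔ t ∈ E := fun t => hE.mem_toFinset
  have hF : ∀ x, x ∈ B.F ↔ (e.symm x).1 ∈ R.F := by simp [B]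
  have store : ∀ (ρ : R.X → Fin p) (σ : Fin p → V) (ℓ : Fin n → V) (f : R.X → R.X ⊕ Fin n),
      (a ρ).run ℓ σ ∘ Sum.elim ρ (β ρ) ∘ f = Sum.elim (σ ∘ ρ) ℓ ∘ f := by
    intro ρ σ ℓ f
    funext x
    rcases h : f x with y | j
    · simp [h, (ha ρ ℓ σ).2 _ (hρβ ρ y)]
    · simp [h, (ha ρ ℓ σ).1 j]
  have sound : ∀ y w z, B.Path y w z → z.1.1 ∈ B.F → ∀ q ρ, y.1.1 = e (q, ρ) →
      R.Accepts w q (y.1.2 ∘ ρ) := by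
    intro y w z h
    induction h with
    | nil y =>
      intro hz q ρ hy
      rw [hF, hy, e.symm_apply_apply] at hz
      exact hz
    | cons hs _ ih =>
      intro hz q ρ hy
      cases hs with
      | @std q₁ s₁ q₂ s₂ gas u w' ht hacc =>
        dsimp only at hy
        subst hy
        rcases (hδ _).1 ht with ⟨⟨q', ρ', b, q'', f⟩, hmem, heq⟩ | ⟨x, heq⟩
        · simp only [edge, Prod.mk.injEq, EmbeddingLike.apply_eq_iff_eq] at heq
          obtain ⟨⟨rfl, rfl⟩, rfl, rfl⟩ := heq
          cases hacc with
          | cons hsat hnil =>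
            cases hnil
            rw [hg] at hsat
            subst hsat
            have := ih hz _ _ rfl
            dsimp only at this
            rw [store] at this
            exact ⟨q'', f, hmem, this⟩
        · simp only [Prod.mk.injEq] at heq
          obtain ⟨rfl, rfl, rfl⟩ := heq
          cases hacc
          exact ih hz q ρ rfl
      | skip hn =>
        exact (hn ⟨_, _, [], [], _, rfl, (hδ _).2 (Or.inr ⟨_, rfl⟩), .nil _⟩).elim
  have complete : ∀ w q ρ σ, R.Accepts w q (σ ∘ ρ) →
      ∃ q' s', B.Path ((e (q, ρ), σ), w) w ((q', s'), []) ∧ q' ∈ B.F := by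
    intro w
    induction w with
    | nil =>
      intro q ρ σ h
      refine ⟨_, _, .nil _, ?_⟩
      rw [hF, e.symm_apply_apply]
      exact h
    | cons ℓ w ih =>
      rintro q ρ σ ⟨q', f, hmem, hw⟩
      rw [← store] at hw
      obtain ⟨q'', s', hpath, hfin⟩ := ih _ _ _ hw
      refine ⟨q'', s', .cons (u := [ℓ]) (.std (w := [ℓ]) (w' := w) ((hδ _).2 (Or.inl
        ⟨(q, ρ, (fun x j => σ (ρ x) = ℓ j), q', f), hmem, rfl⟩)) ?_) hpath, hfin⟩
      exact .cons ((hg _ _ _ _).2 rfl) (.nil _)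
  have hs₀ : B.s₀ ∘ ρ₀ = R.s₀ := by
    funext x
    exact ρ₀.injective.extend_apply R.s₀ (fun _ => Classical.arbitrary V) x
  refine ⟨p, k, B, Set.ext fun w => ⟨?_, fun h => ?_⟩⟩
  · rintro ⟨w₀, q, s, hpath, hq⟩
    have := sound _ _ _ hpath hq R.q₀ ρ₀ rfl
    dsimp only at this
    rw [hs₀] at this
    exact this
  · obtain ⟨q', s', hpath, hq⟩ := complete w R.q₀ ρ₀ B.s₀ (by rw [hs₀]; exact h)
    exact ⟨w, q', s', hpath, hq⟩

end CopyAut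

/-! ### From high-level automata to register automata with copying -/

namespace HlTOPL

variable {V : Type} {m n k : ℕ}

/-- An initial segment of the word is accepted by the sequence of guard–action pairs. -/
def Matches : (Fin m → V) → List (Guard m n × Action m n) → List (Fin n → V) → Prop
  | _, [], _ => True
  | _, _ :: _, [] => False
  | s, ga :: gas, ℓ :: w => ga.1.Sat s ℓ ∧ Matches (ga.2.run ℓ s) gas w

theorem matches_iff (s : Fin m → V) (gas : List (Guard m n × Action m n))
    (w : List (Fin n → V)) :
    Matches s gas w ↔ ∃ s' u u', w = u ++ u' ∧ SeqAccept s gas u s' := by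
  constructor
  · intro h
    induction gas generalizing s w with
    | nil => exact ⟨s, [], w, rfl, .nil s⟩
    | cons ga gas ih =>
      rcases w with _ | ⟨ℓ, w⟩
      · exact h.elim
      · obtain ⟨s', u, u', rfl, hu⟩ := ih _ _ h.2
        exact ⟨s', ℓ :: u, u', rfl, .cons h.1 hu⟩
  · rintro ⟨s', u, u', rfl, h⟩
    induction h with
    | nil s => trivial
    | cons hg _ ih => exact ⟨hg, ih⟩

theorem stdFrom_iff (A : HlTOPL V m n k) (q : Fin k) (s : Fin m → V) (w : List (Fin n → V)) :
    A.StdFrom (q, s) w ↔ ∃ t ∈ A.δ, t.1 = q ∧ Matches s t.2.1 w := by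
  simp only [matches_iff]
  constructor
  · rintro ⟨q₂, s₂, gas, u, u', hw, ht, h⟩
    exact ⟨_, ht, rfl, s₂, u, u', hw, h⟩
  · rintro ⟨⟨_, gas, q₂⟩, ht, rfl, s₂, u, u', hw, h⟩
    exact ⟨q₂, s₂, gas, u, u', hw, ht, h⟩

/-- Letter-by-letter acceptance: `A.Run w g q s` holds when, with store `s`, the pairs `g` of the
current transition to `q` yet to be processed, the word `w` can be accepted. -/
inductive Run (A : HlTOPL V m n k) : List (Fin n → V) → List (Guard m n × Action m n) →
    Fin k → (Fin m → V) → Prop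
  | done {q s} : q ∈ A.F → Run A [] [] q s
  | start {w g q q' s} : (q, g, q') ∈ A.δ → Run A w g q' s → Run A w [] q s
  | adv {w ℓ γ a g q s} : Guard.Sat s ℓ γ → Run A w g q (Action.run ℓ a s) →
      Run A (ℓ :: w) ((γ, a) :: g) q s
  | skip {w ℓ q s} : ¬ A.StdFrom (q, s) (ℓ :: w) → Run A w [] q s → Run A (ℓ :: w) [] q s

theorem Run.of_seqAccept {A : HlTOPL V m n k} {s s' : Fin m → V}
    {g : List (Guard m n × Action m n)} {u w : List (Fin n → V)} {q : Fin k}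
    (h : SeqAccept s g u s') (hr : A.Run w [] q s') : A.Run (u ++ w) g q s := by
  induction h with
  | nil s => exact hr
  | cons hg _ ih => exact .adv hg (ih hr)

theorem Run.of_path {A : HlTOPL V m n k} {y z : (Fin k × (Fin m → V)) × List (Fin n → V)}
    {w : List (Fin n → V)} (h : A.Path y w z) (hz : z.2 = []) (hF : z.1.1 ∈ A.F) :
    y.2 = w ∧ A.Run w [] y.1.1 y.1.2 := by
  induction h with
  | nil y => exact ⟨hz, .done hF⟩
  | cons hs _ ih =>
    obtain ⟨hw, hr⟩ := ih hz hF
    cases hs with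
    | std ht hacc => exact ⟨by simpa using hw, .start ht (.of_seqAccept hacc hr)⟩
    | skip hn =>
      dsimp only at hw
      subst hw
      exact ⟨rfl, .skip hn hr⟩

theorem Run.exists_path {A : HlTOPL V m n k} {w : List (Fin n → V)}
    {g : List (Guard m n × Action m n)} {q : Fin k} {s : Fin m → V} (h : A.Run w g q s) :
    ∃ u u' s' q'' s'', w = u ++ u' ∧ SeqAccept s g u s' ∧
      A.Path ((q, s'), u') u' ((q'', s''), []) ∧ q'' ∈ A.F := by
  induction h with
  | @done q s hF => exact ⟨[], [], s, q, s, rfl, .nil s, .nil _, hF⟩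
  | @start w g q q' s ht _ ih =>
    obtain ⟨u, u', s', q'', s'', rfl, hacc, hpath, hF⟩ := ih
    exact ⟨[], u ++ u', s, q'', s'', rfl, .nil s, .cons (.std ht hacc) hpath, hF⟩
  | adv hg _ ih =>
    obtain ⟨u, u', s', q'', s'', rfl, hacc, hpath, hF⟩ := ih
    exact ⟨_ :: u, u', s', q'', s'', rfl, .cons hg hacc, hpath, hF⟩
  | @skip w ℓ q s hn _ ih =>
    obtain ⟨u, u', s', q'', s'', rfl, hacc, hpath, hF⟩ := ih
    cases hacc
    exact ⟨[], ℓ :: u', s, q'', s'', rfl, .nil s, .cons (.skip hn) hpath, hF⟩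

theorem mem_lang_iff_run (A : HlTOPL V m n k) (w : List (Fin n → V)) :
    w ∈ A.Lang ↔ A.Run w [] A.q₀ A.s₀ := by
  constructor
  · rintro ⟨w₀, q, s, hpath, hq⟩
    exact (Run.of_path hpath rfl hq).2
  · intro h
    obtain ⟨u, u', s', q'', s'', rfl, hacc, hpath, hF⟩ := h.exists_path
    cases hacc
    exact ⟨u', q'', s'', hpath, hF⟩

/-- Reachability by transitions labelled with the empty sequence. -/
def Eps (A : HlTOPL V m n k) : Fin k → Fin k → Prop :=
  Relation.ReflTransGen fun q q' => (q, [], q') ∈ A.δ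

theorem Run.of_eps {A : HlTOPL V m n k} {w : List (Fin n → V)} {q q' : Fin k} {s : Fin m → V}
    (h : A.Eps q q') (hr : A.Run w [] q' s) : A.Run w [] q s := by
  induction h using Relation.ReflTransGen.head_induction_on with
  | refl => exact hr
  | head ht _ ih => exact .start ht ih

theorem run_nil_iff (A : HlTOPL V m n k) (g : List (Guard m n × Action m n)) (q : Fin k)
    (s : Fin m → V) : A.Run [] g q s ↔ g = [] ∧ ∃ q₁, A.Eps q q₁ ∧ q₁ ∈ A.F := by
  constructor
  · intro h
    generalize hw : ([] : List (Fin n → V)) = w at h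
    induction h with
    | @done q s hF => exact ⟨rfl, q, .refl, hF⟩
    | start ht _ ih =>
      obtain ⟨rfl, q₁, he, hF⟩ := ih hw
      exact ⟨rfl, q₁, .head ht he, hF⟩
    | adv => cases hw
    | skip => cases hw
  · rintro ⟨rfl, q₁, he, hF⟩
    exact .of_eps he (.done hF)

/-- Names of the suffixes of the sequences labelling transitions: a transition, and the number of
pairs already processed. -/
abbrev Pos (A : HlTOPL V m n k) : Type :=
  {t // t ∈ A.δ} × Fin ((A.δ.sup fun t => t.2.1.length) + 1)

/-- The pairs yet to be processed. -/
def Pos.rem {A : HlTOPL V m n k} (i : A.Pos) : List (Guard m n × Action m n) :=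
  i.1.1.2.1.drop i.2

theorem Pos.exists_succ {A : HlTOPL V m n k} (i : A.Pos) {ga : Guard m n × Action m n}
    {g : List (Guard m n × Action m n)} (h : i.rem = ga :: g) :
    ∃ i' : A.Pos, i'.1 = i.1 ∧ i'.2.1 = i.2.1 + 1 ∧ i'.rem = g := by
  have hlen : i.1.1.2.1.length ≤ A.δ.sup fun t => t.2.1.length :=
    Finset.le_sup (f := fun t => t.2.1.length) i.1.2
  have hlt : i.2.1 < i.1.1.2.1.length := by
    by_contra hle
    rw [Pos.rem, List.drop_eq_nil_of_le (not_lt.1 hle)] at h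
    cases h
  refine ⟨(i.1, ⟨i.2.1 + 1, by omega⟩), rfl, rfl, ?_⟩
  have h' := congrArg List.tail h
  rwa [Pos.rem, List.tail_drop] at h'

/-- Control locations: a state, or a position inside a transition. -/
abbrev Loc (A : HlTOPL V m n k) : Type := Fin k ⊕ A.Pos

/-- The pairs yet to be processed before the next state is reached. -/
def Loc.rem {A : HlTOPL V m n k} : A.Loc → List (Guard m n × Action m n)
  | .inl _ => []
  | .inr i => i.rem

/-- The next state to be reached. -/
def Loc.tgt {A : HlTOPL V m n k} : A.Loc → Fin k
  | .inl q => q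
  | .inr i => i.1.1.2.2

theorem Loc.exists_succ {A : HlTOPL V m n k} (μ : A.Loc) {ga : Guard m n × Action m n}
    {g : List (Guard m n × Action m n)} (h : μ.rem = ga :: g) :
    ∃ μ' : A.Loc, μ'.rem = g ∧ μ'.tgt = μ.tgt := by
  rcases μ with q | i
  · cases h
  · obtain ⟨i', h₁, -, h₂⟩ := i.exists_succ h
    exact ⟨.inr i', h₂, by simp [Loc.tgt, h₁]⟩

theorem exists_loc {A : HlTOPL V m n k} {q q' : Fin k} {g : List (Guard m n × Action m n)}
    (h : (q, g, q') ∈ A.δ) : ∃ μ : A.Loc, μ.rem = g ∧ μ.tgt = q' :=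
  ⟨.inr (⟨_, h⟩, 0), rfl, rfl⟩

/-- One letter of a run. The action `a` is applied to the store, and the transitions in `S` must
not match the word from the current position on. -/
inductive LocStep (A : HlTOPL V m n k) (b : Fin m → Fin n → Prop) :
    A.Loc → Action m n → Set A.Pos → A.Loc → Prop
  | adv {μ μ' : A.Loc} {γ a} : μ.rem = (γ, a) :: μ'.rem → μ'.tgt = μ.tgt → γ.Holds b →
      LocStep A b μ a ∅ μ'
  | start {μ μ' : A.Loc} {q γ a} : μ.rem = [] → A.Eps μ.tgt q →
      (q, (γ, a) :: μ'.rem, μ'.tgt) ∈ A.δ → γ.Holds b → LocStep A b μ a ∅ μ'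
  | skip {μ : A.Loc} {q} : μ.rem = [] → A.Eps μ.tgt q →
      LocStep A b μ .nop { i | i.2 = 0 ∧ i.1.1.1 = q } (.inl q)

theorem not_stdFrom_iff (A : HlTOPL V m n k) (q : Fin k) (s : Fin m → V)
    (w : List (Fin n → V)) : ¬ A.StdFrom (q, s) w ↔
      ∀ i ∈ { i : A.Pos | i.2 = 0 ∧ i.1.1.1 = q }, ¬ Matches s i.rem w := by
  rw [stdFrom_iff]
  constructor
  · rintro h ⟨t, a⟩ ⟨ha, hq⟩ hm
    dsimp only at ha
    subst ha
    exact h ⟨t.1, t.2, hq, hm⟩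
  · rintro h ⟨t, ht, hq, hm⟩
    exact h (⟨t, ht⟩, 0) ⟨rfl, hq⟩ hm

theorem run_cons_iff (A : HlTOPL V m n k) (ℓ : Fin n → V) (w : List (Fin n → V)) (μ : A.Loc)
    (s : Fin m → V) : A.Run (ℓ :: w) μ.rem μ.tgt s ↔
      ∃ a S μ', A.LocStep (fun i j => s i = ℓ j) μ a S μ' ∧
        (∀ i ∈ S, i.2 = 0 ∧ ¬ Matches s i.rem (ℓ :: w)) ∧
        A.Run w μ'.rem μ'.tgt (a.run ℓ s) := by
  constructor
  · intro h
    generalize hw : ℓ :: w = w' at h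
    generalize hg : μ.rem = g at h
    generalize hq : μ.tgt = q at h
    induction h generalizing μ with
    | done => cases hw
    | @start w' g q q' s ht hr ih =>
      obtain ⟨μ₁, rfl, rfl⟩ := exists_loc ht
      obtain ⟨a, S, μ', hstep, hS, hr'⟩ := ih μ₁ hw rfl rfl
      refine ⟨a, S, μ', ?_, hS, hr'⟩
      subst hq
      cases hstep with
      | adv h₁ h₂ h₃ => exact .start hg .refl (by rwa [← h₁, h₂]) h₃
      | start h₁ h₂ h₃ h₄ => exact .start hg (.head (by rwa [h₁] at ht) h₂) h₃ h₄
      | skip h₁ h₂ => exact .skip hg (.head (by rwa [h₁] at ht) h₂)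
    | @adv w' ℓ' γ a g q s hsat hr =>
      cases hw
      obtain ⟨μ', rfl, h⟩ := μ.exists_succ hg
      subst hq
      exact ⟨a, ∅, μ', .adv hg h ((Guard.holds_iff_sat _ _ _).2 hsat), by simp, h ▸ hr⟩
    | @skip w' ℓ' q s hn hr =>
      cases hw
      subst hq
      exact ⟨.nop, _, _, .skip hg .refl,
        fun i hi => ⟨hi.1, (not_stdFrom_iff _ _ _ _).1 hn i hi⟩, hr⟩
  · rintro ⟨a, S, μ', hstep, hS, hr⟩
    cases hstep with
    | adv h₁ h₂ h₃ =>
      rw [h₁, ← h₂]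
      exact .adv ((Guard.holds_iff_sat _ _ _).1 h₃) hr
    | start h₁ h₂ h₃ h₄ =>
      rw [h₁]
      exact .of_eps h₂ (.start h₃ (.adv ((Guard.holds_iff_sat _ _ _).1 h₄) hr))
    | skip h₁ h₂ =>
      rw [h₁]
      exact .of_eps h₂ (.skip ((not_stdFrom_iff _ _ _ _).2 fun i hi => (hS i hi).2) hr)

/-- Registers: a main store, and a store for each pending sequence. -/
abbrev Reg (A : HlTOPL V m n k) : Type := Fin m ⊕ A.Pos × Fin m

open Classical in
/-- The registers holding the store of a pending sequence. Sequences that have not started share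
the main store. -/
def Pos.reg {A : HlTOPL V m n k} (i : A.Pos) (x : Fin m) : A.Reg :=
  if i.2 = 0 then .inl x else .inr (i, x)

theorem Pos.reg_of_eq_zero {A : HlTOPL V m n k} {i : A.Pos} (h : i.2 = 0) :
    i.reg = Sum.inl := by
  funext x
  simp [Pos.reg, h]

/-- The pending sequences after one letter. -/
def nextPending (A : HlTOPL V m n k) (b : A.Reg → Fin n → Prop) (P : Set A.Pos) : Set A.Pos :=
  { i' | ∃ i ∈ P, i'.1 = i.1 ∧ i'.2.1 = i.2.1 + 1 ∧
    ∃ ga g, i.rem = ga :: g ∧ ga.1.Holds (b ∘ i.reg) }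

open Classical in
/-- The update of all registers on one letter, when `a` is applied to the main store. -/
noncomputable def update (A : HlTOPL V m n k) (a : Action m n) : A.Reg → A.Reg ⊕ Fin n
  | .inl x => a.run Sum.inr (Sum.inl ∘ Sum.inl) x
  | .inr (i', x) =>
    if h : ∃ i : A.Pos, i'.1 = i.1 ∧ i'.2.1 = i.2.1 + 1 ∧ i.rem ≠ [] then
      (h.choose.rem.head h.choose_spec.2.2).2.run Sum.inr (Sum.inl ∘ h.choose.reg) x
    else .inl (.inr (i', x))

theorem elim_update_inl (A : HlTOPL V m n k) (a : Action m n) (s : A.Reg → V) (ℓ : Fin n → V) :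
    (Sum.elim s ℓ ∘ A.update a) ∘ Sum.inl = a.run ℓ (s ∘ Sum.inl) := by
  funext x
  exact a.elim_run s ℓ Sum.inl x

theorem elim_update_reg (A : HlTOPL V m n k) (a : Action m n) (s : A.Reg → V) (ℓ : Fin n → V)
    {i i' : A.Pos} (h₁ : i'.1 = i.1) (h₂ : i'.2.1 = i.2.1 + 1) {ga : Guard m n × Action m n}
    {g : List (Guard m n × Action m n)} (hi : i.rem = ga :: g) :
    (Sum.elim s ℓ ∘ A.update a) ∘ i'.reg = ga.2.run ℓ (s ∘ i.reg) := by
  funext x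
  have h0 : i'.2 ≠ 0 := fun h => by simp [h] at h₂
  have h : ∃ i : A.Pos, i'.1 = i.1 ∧ i'.2.1 = i.2.1 + 1 ∧ i.rem ≠ [] :=
    ⟨i, h₁, h₂, by simp [hi]⟩
  have hc : h.choose = i := by
    obtain ⟨c₁, c₂, -⟩ := h.choose_spec
    exact Prod.ext (c₁.symm.trans h₁) (Fin.ext (by omega))
  have hhead : h.choose.rem.head h.choose_spec.2.2 = ga := by
    simp only [hc, hi, List.head_cons]
  simp only [Function.comp_apply, Pos.reg, if_neg h0, update, dif_pos h, hhead]
  rw [hc]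
  exact ga.2.elim_run s ℓ i.reg x

theorem pending_cons_iff (A : HlTOPL V m n k) (a : Action m n) (s : A.Reg → V) (ℓ : Fin n → V)
    (w : List (Fin n → V)) (P : Set A.Pos) :
    (∀ i ∈ P, ¬ Matches (s ∘ i.reg) i.rem (ℓ :: w)) ↔
      (∀ i ∈ P, i.rem ≠ []) ∧ ∀ i ∈ A.nextPending (fun x j => s x = ℓ j) P,
        ¬ Matches ((Sum.elim s ℓ ∘ A.update a) ∘ i.reg) i.rem w := by
  constructor
  · refine fun h => ⟨fun i hi h0 => h i hi (by rw [h0]; trivial), ?_⟩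
    rintro i' ⟨i, hi, h₁, h₂, ga, g, hrem, hsat⟩ hm
    rw [elim_update_reg A a s ℓ h₁ h₂ hrem] at hm
    have hrem' : i'.rem = g := by
      have h' := congrArg List.tail hrem
      rw [Pos.rem, List.tail_drop] at h'
      rw [Pos.rem, h₁, h₂]
      exact h'
    apply h i hi
    rw [hrem]
    exact ⟨(Guard.holds_iff_sat _ _ _).1 hsat, hrem' ▸ hm⟩
  · rintro ⟨h0, h⟩ i hi hm
    rcases hrem : i.rem with _ | ⟨ga, g⟩
    · exact h0 i hi hrem
    · rw [hrem] at hm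
      obtain ⟨i', h₁, h₂, hrem'⟩ := i.exists_succ hrem
      apply h i' ⟨i, hi, h₁, h₂, ga, g, hrem, (Guard.holds_iff_sat _ _ _).2 hm.1⟩
      rw [elim_update_reg A a s ℓ h₁ h₂ hrem, hrem']
      exact hm.2

/-- The register automaton with copying that processes the input letter by letter. When a letter is
skipped, the sequences that must not match become pending. -/
noncomputable def toCopyAut (A : HlTOPL V m n k) : CopyAut V n where
  Q := A.Loc × Set A.Pos
  X := A.Reg
  finQ := inferInstance
  finX := inferInstance
  q₀ := (.inl A.q₀, ∅)
  s₀ := Sum.elim A.s₀ (A.s₀ ∘ Prod.snd)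
  δ q b := { p | ∃ a S, A.LocStep (b ∘ Sum.inl) q.1 a S p.1.1 ∧
    (∀ i ∈ q.2 ∪ S, i.rem ≠ []) ∧ p.1.2 = A.nextPending b (q.2 ∪ S) ∧ p.2 = A.update a }
  F := { q | q.1.rem = [] ∧ (∃ q₁, A.Eps q.1.tgt q₁ ∧ q₁ ∈ A.F) ∧ ∀ i ∈ q.2, i.rem ≠ [] }

theorem LocStep.snd_eq_zero {A : HlTOPL V m n k} {b : Fin m → Fin n → Prop} {μ μ' : A.Loc}
    {a : Action m n} {S : Set A.Pos} (h : A.LocStep b μ a S μ') : ∀ i ∈ S, i.2 = 0 := by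
  cases h with
  | adv => simp
  | start => simp
  | skip => exact fun i hi => hi.1

theorem accepts_toCopyAut_iff (A : HlTOPL V m n k) (w : List (Fin n → V)) (μ : A.Loc)
    (P : Set A.Pos) (s : A.Reg → V) :
    A.toCopyAut.Accepts w (μ, P) s ↔
      A.Run w μ.rem μ.tgt (s ∘ Sum.inl) ∧ ∀ i ∈ P, ¬ Matches (s ∘ i.reg) i.rem w := by
  induction w generalizing μ P s with
  | nil =>
    have : ∀ i : A.Pos, ¬ Matches (s ∘ i.reg) i.rem ([] : List (Fin n → V)) ↔ i.rem ≠ [] := by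
      intro i
      rcases i.rem with _ | ⟨ga, g⟩ <;> simp [Matches]
    simp only [run_nil_iff, this, and_assoc]
    rfl
  | cons ℓ w ih =>
    rw [run_cons_iff]
    constructor
    · rintro ⟨⟨μ', P'⟩, f, ⟨a, S, hstep, hne, hP, hf⟩, hw⟩
      dsimp only at hstep hne hP hf
      subst hP hf
      obtain ⟨hr, hpend⟩ := (ih _ _ _).1 hw
      have hall := (pending_cons_iff A a s ℓ w (P ∪ S)).2 ⟨hne, hpend⟩
      have hr' := (congrArg (A.Run w _ _) (elim_update_inl A a s ℓ)).mp hr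
      refine ⟨⟨a, S, μ', hstep, fun i hi => ?_, hr'⟩, fun i hi => hall i (.inl hi)⟩
      have h0 := hstep.snd_eq_zero i hi
      have := hall i (.inr hi)
      rw [Pos.reg_of_eq_zero h0] at this
      exact ⟨h0, this⟩
    · rintro ⟨⟨a, S, μ', hstep, hS, hr⟩, hpend⟩
      have hall : ∀ i ∈ P ∪ S, ¬ Matches (s ∘ i.reg) i.rem (ℓ :: w) := by
        rintro i (hi | hi)
        · exact hpend i hi
        · rw [Pos.reg_of_eq_zero (hS i hi).1]
          exact (hS i hi).2
      obtain ⟨hne, hnext⟩ := (pending_cons_iff A a s ℓ w (P ∪ S)).1 hall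
      refine ⟨(μ', _), _, ⟨a, S, hstep, hne, rfl, rfl⟩, (ih _ _ _).2 ⟨?_, hnext⟩⟩
      exact (congrArg (A.Run w _ _) (elim_update_inl A a s ℓ)).mpr hr

theorem lang_toCopyAut (A : HlTOPL V m n k) : A.toCopyAut.Lang = A.Lang := by
  ext w
  rw [mem_lang_iff_run]
  refine (accepts_toCopyAut_iff A w (.inl A.q₀) ∅ _).trans ?_
  simp [Loc.rem, Loc.tgt, toCopyAut]

end HlTOPL

/-- hl-TOPL-recognizable languages are closed under intersection. -/
theorem hlTopl_closed_under_intersection (V : Type) [Infinite V] (n : ℕ)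
    (m₁ k₁ m₂ k₂ : ℕ) (A₁ : HlTOPL V m₁ n k₁) (A₂ : HlTOPL V m₂ n k₂) :
    ∃ (m k : ℕ) (B : HlTOPL V m n k), B.Lang = A₁.Lang ∩ A₂.Lang := by
  rw [← A₁.lang_toCopyAut, ← A₂.lang_toCopyAut, ← CopyAut.lang_prod]
  exact CopyAut.exists_hlTOPL _

end Topl
end
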